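/- Let z ∈ ℂ with Im z > 0, q := e(z), and let (α,β) ∈ (−1,1)² with (α,β) ≠ (0,0) and w := α + βz. Then σ(w | 1,z) = exp( (π²/6)·E₂(z)·w² + sgn(β)·πi·(1/2 − w) ) · (2 sin πα)^{δ(β)} · (e(α)·q^{⟨β⟩'}; q)_∞ · (e(−α)·q^{⟨−β⟩'}; q)_∞ / ( 2π·(q;q)_∞² ), where sgn(β) ∈ {−1,0,1}, δ(β) = 1 if β = 0 and 0 otherwise (so the factor (2 sin πα)^{δ(β)} equals 2 sin πα when β = 0 and 1 otherwise), and q^{⟨β⟩'} := e(⟨β⟩'·z). -/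

import Mathlib

noncomputable section

open Complex MeasureTheory
open scoped Real Classical

/-- `e(s) = exp(2 π i s)`. -/
def ee (s : ℂ) : ℂ := Complex.exp (2 * (Real.pi : ℂ) * Complex.I * s)

/-- `δ(x) = 1` if `x ∈ ℤ`, `0` otherwise. -/
def dInt (x : ℝ) : ℂ := if ∃ n : ℤ, (n : ℝ) = x then 1 else 0

/-- The Lerch zeta function `ψ(r,γ,κ) = Σ_{k ∈ ℤ, γ+k>0} e((γ+k)κ) (γ+k)^{-r}`
(a convergent series when `Re r > 1`). -/
def psiL (r : ℂ) (γ κ : ℝ) : ℂ :=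
  ∑' k : {k : ℤ // 0 < γ + (k : ℝ)},
    ee ((((γ + (k.1 : ℝ)) * κ : ℝ)) : ℂ) * (((γ + (k.1 : ℝ)) : ℝ) : ℂ) ^ (-r)

/-- The `q`-series `𝒮_r(γ,δ;κ,λ;q)`, where `q = e^{-2πt}` with `Re t > 0`, and the power
`q^{(γ+k)(δ+l)}` is interpreted as `exp (-2πt(γ+k)(δ+l))`. -/
def Scal (r : ℂ) (γ δ' κ lam : ℝ) (t : ℂ) : ℂ :=
  ∑' (k : {k : ℤ // 0 < γ + (k : ℝ)}) (l : {l : ℤ // 0 < δ' + (l : ℝ)}),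
    ee ((((γ + (k.1 : ℝ)) * κ + (δ' + (l.1 : ℝ)) * lam : ℝ)) : ℂ) *
      (((δ' + (l.1 : ℝ)) : ℝ) : ℂ) ^ (-r) *
      Complex.exp (-2 * (Real.pi : ℂ) * t * ((γ + (k.1 : ℝ) : ℝ) : ℂ) * ((δ' + (l.1 : ℝ) : ℝ) : ℂ))

/-- The generalized Eisenstein series `F_{ℤ²}(s;α,β;μ,ν;z)` (mean of the two branch
conventions), defined by an absolutely convergent series for `Re s > 2`. -/
def Fz2 (s : ℂ) (α β μ ν : ℝ) (z : ℂ) : ℂ :=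
  (∑' p : {p : ℤ × ℤ // β + (p.2 : ℝ) ≠ 0},
      ee ((((α + (p.1.1 : ℝ)) * μ + (β + (p.1.2 : ℝ)) * ν : ℝ)) : ℂ) *
        ((((α + (p.1.1 : ℝ)) : ℝ) : ℂ) + (((β + (p.1.2 : ℝ)) : ℝ) : ℂ) * z) ^ (-s)) +
  dInt β *
    ((∑' m : {m : ℤ // 0 < α + (m : ℝ)},
        ee ((((α + (m.1 : ℝ)) * μ : ℝ)) : ℂ) * (((α + (m.1 : ℝ)) : ℝ) : ℂ) ^ (-s)) +
      Complex.cos ((Real.pi : ℂ) * s) *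
        ∑' m : {m : ℤ // α + (m : ℝ) < 0},
          ee ((((α + (m.1 : ℝ)) * μ : ℝ)) : ℂ) * ((|α + (m.1 : ℝ)| : ℝ) : ℂ) ^ (-s))

/-- `𝒜(s,α,μ) = cos(πs) ψ(s,-α,-μ) + ψ(s,α,μ)`. -/
def Acal (s : ℂ) (α μ : ℝ) : ℂ :=
  Complex.cos ((Real.pi : ℂ) * s) * psiL s (-α) (-μ) + psiL s α μ

/-- `ψ(k,γ,κ)` at an integer `k`: the convergent series for `k ≥ 2`, the value
`-𝒞_{1-k}(⟨γ⟩,κ)/(1-k) - δ_{k0} δ(γ)` of the analytic continuation for `k ≤ 0`,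
and the (irrelevant) value `0` for `k = 1`; here `C` is the family of Taylor
coefficients `𝒞`. -/
def psiIntC (C : ℕ → ℂ → ℝ → ℂ) (k : ℤ) (γ κ : ℝ) : ℂ :=
  if 2 ≤ k then
    ∑' n : {n : ℤ // 0 < γ + (n : ℝ)},
      ee ((((γ + (n.1 : ℝ)) * κ : ℝ)) : ℂ) * (((γ + (n.1 : ℝ)) : ℝ) : ℂ) ^ (-k)
  else if k ≤ 0 then
    -C (1 - k).toNat ((Int.fract γ : ℝ) : ℂ) κ / ((1 : ℂ) - (k : ℂ)) -
      (if k = 0 then dInt γ else 0)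
  else 0

/-- The Bernoulli polynomial `B_j(x)` evaluated in `ℂ`. -/
def BpolyC (j : ℕ) (x : ℂ) : ℂ := Polynomial.aeval x (Polynomial.bernoulli j)

/-- Weierstrass `℘`-function with periods `(1, z)`. -/
def wpFn (z w : ℂ) : ℂ :=
  w ^ (-2 : ℤ) + ∑' p : {p : ℤ × ℤ // p ≠ (0, 0)},
    ((w - (p.1.1 : ℂ) - (p.1.2 : ℂ) * z) ^ (-2 : ℤ) -
      ((p.1.1 : ℂ) + (p.1.2 : ℂ) * z) ^ (-2 : ℤ))

/-- Weierstrass zeta function with periods `(1, z)`. -/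
def wzetaFn (z w : ℂ) : ℂ :=
  1 / w + ∑' p : {p : ℤ × ℤ // p ≠ (0, 0)},
    (1 / (w - (p.1.1 : ℂ) - (p.1.2 : ℂ) * z) + 1 / ((p.1.1 : ℂ) + (p.1.2 : ℂ) * z) +
      w / ((p.1.1 : ℂ) + (p.1.2 : ℂ) * z) ^ 2)

/-- Weierstrass sigma function with periods `(1, z)`. -/
def wsigmaFn (z w : ℂ) : ℂ :=
  w * ∏' p : {p : ℤ × ℤ // p ≠ (0, 0)},
    ((1 - w / ((p.1.1 : ℂ) + (p.1.2 : ℂ) * z)) *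
      Complex.exp (w / ((p.1.1 : ℂ) + (p.1.2 : ℂ) * z) +
        w ^ 2 / (2 * ((p.1.1 : ℂ) + (p.1.2 : ℂ) * z) ^ 2)))

/-- The `q`-Pochhammer symbol `(Z;q)_∞`. -/
def qPoch (Z q : ℂ) : ℂ := ∏' l : ℕ, (1 - Z * q ^ l)

/-- `⟨x⟩' = 1 - ⟨-x⟩`. -/
def fracP (x : ℝ) : ℝ := 1 - Int.fract (-x)

/-- The Eisenstein series `E₂`. -/
def E2cl (z : ℂ) : ℂ := 1 - 24 * ∑' l : ℕ+, (l : ℂ) * ee z ^ (l : ℕ) / (1 - ee z ^ (l : ℕ))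

/-- `a_{2k}`: `ζ(1-2k)` for `k ≠ 0` and `2ζ'(0) = -log 2π` for `k = 0`. -/
def acoef (k : ℤ) : ℂ :=
  if k = 0 then -(Real.log (2 * Real.pi) : ℂ) else riemannZeta ((1 - 2 * k : ℤ) : ℂ)

/-- The classical Eisenstein series `E_{2k}`. -/
def Ecl (k : ℤ) (z : ℂ) : ℂ :=
  1 + (2 / acoef k) * ∑' l : ℕ+, (l : ℂ) ^ (2 * k - 1) * ee z ^ (l : ℕ) / (1 - ee z ^ (l : ℕ))

/-- The bilateral Lerch zeta function `ψ_ℤ^ε(r,γ,κ) = e^{-επir} ψ(r,-γ,-κ) + ψ(r,γ,κ)`. -/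
def psiZpm (ε : ℤ) (r : ℂ) (γ κ : ℝ) : ℂ :=
  Complex.exp (-(ε : ℂ) * (Real.pi : ℂ) * Complex.I * r) * psiL r (-γ) (-κ) + psiL r γ κ

open Filter Topology Finset in
/-- Splitting off both endpoints of a product over a symmetric interval of integers. -/
theorem prod_Icc_neg_succ {M : Type*} [CommMonoid M] (f : ℤ → M) (N : ℕ) :
    ∏ m ∈ Icc (-((N + 1 : ℕ) : ℤ)) ((N + 1 : ℕ) : ℤ), f m =
      (∏ m ∈ Icc (-(N : ℤ)) N, f m) * (f ((N + 1 : ℕ) : ℤ) * f (-((N + 1 : ℕ) : ℤ))) := by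
  have h : Icc (-((N + 1 : ℕ) : ℤ)) ((N + 1 : ℕ) : ℤ) =
      insert ((N + 1 : ℕ) : ℤ) (insert (-((N + 1 : ℕ) : ℤ)) (Icc (-(N : ℤ)) N)) := by
    ext x
    simp only [mem_Icc, mem_insert]
    omega
  rw [h, prod_insert, prod_insert]
  · rw [← mul_assoc, mul_comm]
  · simp only [mem_Icc]; omega
  · simp only [mem_Icc, mem_insert]; omega

open Filter Topology Finset in
theorem sum_Icc_neg_succ {M : Type*} [AddCommMonoid M] (f : ℤ → M) (N : ℕ) :
    ∑ m ∈ Icc (-((N + 1 : ℕ) : ℤ)) ((N + 1 : ℕ) : ℤ), f m =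
      (∑ m ∈ Icc (-(N : ℤ)) N, f m) + (f ((N + 1 : ℕ) : ℤ) + f (-((N + 1 : ℕ) : ℤ))) :=
  prod_Icc_neg_succ (M := Multiplicative M) f N

open Filter Topology Finset in
theorem HasProd.tendsto_prod_Icc_neg {f : ℤ → ℂ} {a : ℂ} (h : HasProd f a) :
    Tendsto (fun N : ℕ ↦ ∏ m ∈ Icc (-(N : ℤ)) N, f m) atTop (𝓝 a) :=
  Tendsto.comp (g := fun s ↦ ∏ m ∈ s, f m) (by simpa [HasProd] using h)
    (tendsto_Icc_neg.comp tendsto_natCast_atTop_atTop)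

open Filter Topology Finset in
theorem HasSum.tendsto_sum_Icc_neg {f : ℤ → ℂ} {a : ℂ} (h : HasSum f a) :
    Tendsto (fun N : ℕ ↦ ∑ m ∈ Icc (-(N : ℤ)) N, f m) atTop (𝓝 a) :=
  Tendsto.comp (g := fun s ↦ ∑ m ∈ s, f m) (by simpa [HasSum] using h)
    (tendsto_Icc_neg.comp tendsto_natCast_atTop_atTop)

/-- The Weierstrass primary factor of genus two. -/
def primaryFactor (x : ℂ) : ℂ := (1 - x) * Complex.exp (x + x ^ 2 / 2)

theorem primaryFactor_zero : primaryFactor 0 = 1 := by simp [primaryFactor]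

theorem primaryFactor_mul_neg (x : ℂ) :
    primaryFactor x * primaryFactor (-x) = (1 - x) * (1 + x) * Complex.exp (x ^ 2) := by
  have : Complex.exp (x ^ 2) = Complex.exp (x + x ^ 2 / 2) * Complex.exp (-x + (-x) ^ 2 / 2) := by
    rw [← Complex.exp_add]; ring_nf
  rw [this, primaryFactor, primaryFactor]
  ring

theorem norm_primaryFactor_sub_one_le {x : ℂ} (hx : ‖x‖ ≤ 1 / 2) :
    ‖primaryFactor x - 1‖ ≤ 2 * ‖x‖ ^ 3 := by
  have hx0 := norm_nonneg x
  have hx1 : ‖-x‖ < 1 := by rw [norm_neg]; linarith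
  have hlog := Complex.norm_log_sub_logTaylor_le 2 hx1
  have hT : Complex.logTaylor (2 + 1) (-x) = -(x + x ^ 2 / 2) := by
    simp [Complex.logTaylor, Finset.sum_range_succ]
    ring
  rw [hT, sub_neg_eq_add, norm_neg, ← sub_eq_add_neg] at hlog
  have hinv : (1 - ‖x‖)⁻¹ ≤ 2 := by
    rw [inv_le_comm₀ (by linarith) (by norm_num)]; linarith
  set t := Complex.log (1 - x) + (x + x ^ 2 / 2) with ht
  have hx3 : ‖x‖ ^ 3 ≤ 1 / 8 := by
    calc ‖x‖ ^ 3 ≤ (1 / 2) ^ 3 := by gcongr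
      _ = 1 / 8 := by norm_num
  have h2 : ‖t‖ ≤ ‖x‖ ^ 3 := by
    refine hlog.trans ?_
    have : ‖x‖ ^ (2 + 1) * (1 - ‖x‖)⁻¹ ≤ ‖x‖ ^ 3 * 2 := by gcongr
    have h0 : 0 ≤ ‖x‖ ^ 3 := by positivity
    push_cast
    linarith
  have hne : 1 - x ≠ 0 := by
    intro h
    have : x = 1 := by linear_combination -h
    rw [this] at hx
    norm_num at hx
  have hexp : primaryFactor x = Complex.exp t := by
    rw [ht, Complex.exp_add, Complex.exp_log hne, primaryFactor]
  rw [hexp]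
  refine (Complex.norm_exp_sub_one_le (by linarith)).trans ?_
  linarith

open Filter in
theorem summable_norm_primaryFactor_sub_one {ι : Type*} {x : ι → ℂ}
    (h : Summable fun i ↦ ‖x i‖ ^ 3) : Summable fun i ↦ ‖primaryFactor (x i) - 1‖ := by
  refine Summable.of_norm_bounded_eventually (h.mul_left 2) ?_
  filter_upwards [h.tendsto_cofinite_zero.eventually
    (gt_mem_nhds (show (0 : ℝ) < 1 / 8 by norm_num))] with i hi
  rw [norm_norm]
  refine norm_primaryFactor_sub_one_le ?_
  by_contra! hlt
  have : (1 / 2 : ℝ) ^ 3 < ‖x i‖ ^ 3 := by gcongr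
  norm_num at this hi
  linarith

theorem summable_norm_lattice_cube {z : ℂ} (hz : 0 < z.im) (w : ℂ) :
    Summable fun p : ℤ × ℤ ↦ ‖w / ((p.2 : ℂ) + (p.1 : ℂ) * z)‖ ^ 3 := by
  have h := EisensteinSeries.summable_norm_eisSummand (k := 3) le_rfl ⟨z, hz⟩
  have h' := ((finTwoArrowEquiv ℤ).symm.summable_iff.mpr h).mul_left (‖w‖ ^ 3)
  refine h'.congr fun p ↦ ?_
  simp only [Function.comp, EisensteinSeries.eisSummand, finTwoArrowEquiv_symm_apply]
  simp [div_eq_mul_inv, mul_pow, zpow_neg, add_comm]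

theorem multipliable_of_summable_norm_sub_one {ι : Type*} {f : ι → ℂ}
    (h : Summable fun i ↦ ‖f i - 1‖) : Multipliable f := by
  simpa using multipliable_one_add_of_summable h

open Filter Topology Finset in
/-- The partial products of the sine function in terms of products over symmetric intervals. -/
theorem prod_Icc_add_eq (a : ℂ) (N : ℕ) :
    ∏ m ∈ Icc (-(N : ℤ)) N, (a + (m : ℂ)) =
      (π * a * ∏ j ∈ range N, ((1 : ℂ) - a ^ 2 / ((j : ℂ) + 1) ^ 2)) *
        ((π : ℂ)⁻¹ * ∏ j ∈ range N, (-((j : ℂ) + 1) ^ 2)) := by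
  have hpi : (π : ℂ) ≠ 0 := by exact_mod_cast Real.pi_ne_zero
  induction N with
  | zero => simp; field_simp
  | succ N ih =>
    rw [prod_Icc_neg_succ, ih, prod_range_succ, prod_range_succ]
    have hN : (N : ℂ) + 1 ≠ 0 := by exact_mod_cast N.succ_ne_zero
    have : (a + (((N + 1 : ℕ) : ℤ) : ℂ)) * (a + ((-((N + 1 : ℕ) : ℤ) : ℤ) : ℂ)) =
        (1 - a ^ 2 / ((N : ℂ) + 1) ^ 2) * (-((N : ℂ) + 1) ^ 2) := by
      push_cast
      field_simp
      ring
    rw [this]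
    ring

open Filter Topology Finset in
theorem tendsto_prod_Icc_add_div_add (a : ℂ) {b : ℂ} (hb : Complex.sin (π * b) ≠ 0) :
    Tendsto (fun N : ℕ ↦ ∏ m ∈ Icc (-(N : ℤ)) N, ((a + (m : ℂ)) / (b + (m : ℂ)))) atTop
      (𝓝 (Complex.sin (π * a) / Complex.sin (π * b))) := by
  refine ((Complex.tendsto_euler_sin_prod a).div (Complex.tendsto_euler_sin_prod b) hb).congr
    fun N ↦ ?_
  rw [prod_div_distrib, prod_Icc_add_eq, prod_Icc_add_eq, mul_div_mul_right]
  · rfl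
  refine mul_ne_zero (inv_ne_zero (by exact_mod_cast Real.pi_ne_zero)) (prod_ne_zero_iff.mpr ?_)
  intro j _
  exact neg_ne_zero.mpr (pow_ne_zero _ (by exact_mod_cast j.succ_ne_zero))

/-- The product over one row of the lattice of the primary factors. -/
def rowProd (z w : ℂ) (n : ℤ) : ℂ := ∏' m : ℤ, primaryFactor (w / ((m : ℂ) + (n : ℂ) * z))

theorem hasProd_rowProd {z : ℂ} (hz : 0 < z.im) (w : ℂ) (n : ℤ) :
    HasProd (fun m : ℤ ↦ primaryFactor (w / ((m : ℂ) + (n : ℂ) * z))) (rowProd z w n) :=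
  (multipliable_of_summable_norm_sub_one (summable_norm_primaryFactor_sub_one
    ((summable_norm_lattice_cube hz w).prod_factor n))).hasProd

theorem wsigmaFn_eq_mul_tprod (z w : ℂ) :
    wsigmaFn z w =
      w * ∏' p : ℤ × ℤ, primaryFactor (w / ((p.2 : ℂ) + (p.1 : ℂ) * z)) := by
  have h : Function.mulSupport (fun p : ℤ × ℤ ↦ primaryFactor (w / ((p.1 : ℂ) + (p.2 : ℂ) * z))) ⊆
      {p | p ≠ (0, 0)} := by
    intro p hp hp0
    rw [hp0] at hp
    simp [primaryFactor_zero] at hp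
  rw [← (Equiv.prodComm ℤ ℤ).tprod_eq]
  simp only [Equiv.prodComm_apply, Prod.fst_swap, Prod.snd_swap]
  rw [← tprod_subtype_eq_of_mulSupport_subset h, wsigmaFn]
  congr 1
  refine tprod_congr fun p ↦ ?_
  rw [primaryFactor]
  congr 3
  rw [div_pow, div_div, mul_comm (_ ^ 2) (2 : ℂ)]

theorem hasProd_rowProd_total {z : ℂ} (hz : 0 < z.im) (w : ℂ) :
    HasProd (rowProd z w)
      (∏' p : ℤ × ℤ, primaryFactor (w / ((p.2 : ℂ) + (p.1 : ℂ) * z))) :=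
  (multipliable_of_summable_norm_sub_one (summable_norm_primaryFactor_sub_one
    (summable_norm_lattice_cube hz w))).hasProd.prod_fiberwise fun n ↦ hasProd_rowProd hz w n

theorem hasSum_e2Summand {z : ℂ} (hz : 0 < z.im) (n : ℤ) :
    HasSum (fun m : ℤ ↦ (1 : ℂ) / ((m : ℂ) + (n : ℂ) * z) ^ 2)
      (EisensteinSeries.e2Summand n ⟨z, hz⟩) := by
  refine (EisensteinSeries.e2Summand_summable n ⟨z, hz⟩).hasSum.congr_fun fun m ↦ ?_
  simp [EisensteinSeries.eisSummand, add_comm, zpow_neg]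

open Filter Topology Finset in
theorem mul_rowProd_zero {z : ℂ} (hz : 0 < z.im) (w : ℂ) :
    w * rowProd z w 0 = Complex.sin (π * w) / π *
      Complex.exp (w ^ 2 / 2 * EisensteinSeries.e2Summand 0 ⟨z, hz⟩) := by
  refine tendsto_nhds_unique ((hasProd_rowProd hz w 0).tendsto_prod_Icc_neg.const_mul w) ?_
  refine (((Complex.tendsto_euler_sin_prod w).div_const (π : ℂ)).mul
    (((hasSum_e2Summand hz 0).tendsto_sum_Icc_neg.const_mul (w ^ 2 / 2)).cexp)).congr fun N ↦ ?_
  induction N with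
  | zero => simp [primaryFactor_zero]
  | succ N ih =>
    rw [prod_Icc_neg_succ, sum_Icc_neg_succ, prod_range_succ, ← mul_assoc w, ← ih]
    have hN : (N : ℂ) + 1 ≠ 0 := by exact_mod_cast N.succ_ne_zero
    have hneg : w / (((-((N + 1 : ℕ) : ℤ) : ℤ) : ℂ) + ((0 : ℤ) : ℂ) * z) =
        -(w / ((((N + 1 : ℕ) : ℤ) : ℂ) + ((0 : ℤ) : ℂ) * z)) := by
      push_cast
      rw [zero_mul, add_zero, add_zero, div_neg]
    rw [hneg, primaryFactor_mul_neg, mul_add, Complex.exp_add]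
    have h1 : w ^ 2 / 2 * (1 / ((((N + 1 : ℕ) : ℤ) : ℂ) + ((0 : ℤ) : ℂ) * z) ^ 2 +
        1 / (((-((N + 1 : ℕ) : ℤ) : ℤ) : ℂ) + ((0 : ℤ) : ℂ) * z) ^ 2) =
        (w / ((((N + 1 : ℕ) : ℤ) : ℂ) + ((0 : ℤ) : ℂ) * z)) ^ 2 := by
      rw [Int.cast_neg, Int.cast_zero, zero_mul, add_zero, add_zero, neg_sq, div_pow]
      ring
    rw [h1]
    have h2 : (1 : ℂ) - w ^ 2 / ((N : ℂ) + 1) ^ 2 =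
        (1 - w / ((((N + 1 : ℕ) : ℤ) : ℂ) + ((0 : ℤ) : ℂ) * z)) *
        (1 + w / ((((N + 1 : ℕ) : ℤ) : ℂ) + ((0 : ℤ) : ℂ) * z)) := by
      push_cast
      field_simp
      ring
    rw [h2]
    ring

theorem ee_add (a b : ℂ) : ee (a + b) = ee a * ee b := by
  rw [ee, ee, ee, ← Complex.exp_add]; ring_nf

theorem ee_zero : ee 0 = 1 := by simp [ee]

theorem ee_ne_zero (a : ℂ) : ee a ≠ 0 := Complex.exp_ne_zero _

theorem ee_natCast_mul (n : ℕ) (a : ℂ) : ee (n * a) = ee a ^ n := by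
  rw [ee, ee, ← Complex.exp_nat_mul]; ring_nf

theorem norm_ee (a : ℂ) : ‖ee a‖ = Real.exp (-(2 * π * a.im)) := by
  rw [ee, Complex.norm_exp]
  simp

theorem norm_ee_lt_one {z : ℂ} (hz : 0 < z.im) : ‖ee z‖ < 1 := by
  rw [norm_ee, Real.exp_lt_one_iff]
  have := Real.pi_pos
  have : 0 < 2 * π * z.im := by positivity
  linarith

theorem sin_pi_mul_eq_ee (a : ℂ) :
    Complex.sin (π * a) = Complex.I / 2 * ee (-(a / 2)) * (1 - ee a) := by
  have h : ee (-(a / 2)) * ee a = ee (a / 2) := by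
    rw [← ee_add]; ring_nf
  rw [mul_sub, mul_one, mul_assoc _ _ (ee a), h, ee, ee, Complex.sin]
  ring_nf

theorem sin_pi_mul_ne_zero_of_norm_ee_lt_one {a : ℂ} (ha : ‖ee a‖ < 1) :
    Complex.sin (π * a) ≠ 0 := by
  rw [sin_pi_mul_eq_ee]
  refine mul_ne_zero (mul_ne_zero (by simp) (ee_ne_zero _)) ?_
  intro h
  rw [← sub_eq_zero.mp h, norm_one] at ha
  exact lt_irrefl _ ha

theorem sin_mul_sin_div_sq (τ w : ℂ) :
    Complex.sin (π * (τ - w)) / Complex.sin (π * τ) *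
      (Complex.sin (π * (τ + w)) / Complex.sin (π * τ)) =
    (1 - ee τ * ee w) * (1 - ee τ * ee (-w)) / (1 - ee τ) ^ 2 := by
  have h : ee (-((τ - w) / 2)) * ee (-((τ + w) / 2)) = ee (-(τ / 2)) ^ 2 := by
    rw [sq, ← ee_add, ← ee_add]; ring_nf
  rw [← ee_add, ← ee_add, ← sub_eq_add_neg, div_mul_div_comm, sin_pi_mul_eq_ee, sin_pi_mul_eq_ee,
    sin_pi_mul_eq_ee τ]
  have hc : (Complex.I / 2) ^ 2 * ee (-(τ / 2)) ^ 2 ≠ 0 :=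
    mul_ne_zero (pow_ne_zero _ (by simp)) (pow_ne_zero _ (ee_ne_zero _))
  rw [← mul_div_mul_left _ ((1 - ee τ) ^ 2) hc]
  congr 1
  · rw [← h]; ring
  · ring

open Filter Topology Finset in
theorem rowProd_mul_rowProd_neg {z : ℂ} (hz : 0 < z.im) (w : ℂ) (n : ℕ) :
    rowProd z w ((n + 1 : ℕ) : ℤ) * rowProd z w (-((n + 1 : ℕ) : ℤ)) =
      (1 - ee z * ee w * ee z ^ n) * (1 - ee z * ee (-w) * ee z ^ n) /
        (1 - ee z * ee z ^ n) ^ 2 *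
      Complex.exp (w ^ 2 * EisensteinSeries.e2Summand ((n + 1 : ℕ) : ℤ) ⟨z, hz⟩) := by
  set τ : ℂ := ((n + 1 : ℕ) : ℂ) * z with hτ
  have hτim : 0 < τ.im := by
    rw [hτ, ← Complex.ofReal_natCast, Complex.im_ofReal_mul]
    positivity
  have hτe : ee τ = ee z * ee z ^ n := by rw [hτ, ee_natCast_mul, pow_succ']
  have hsin : Complex.sin (π * τ) ≠ 0 :=
    sin_pi_mul_ne_zero_of_norm_ee_lt_one (norm_ee_lt_one hτim)
  have hτm (m : ℤ) : τ + (m : ℂ) ≠ 0 := by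
    intro h
    have := congrArg Complex.im h
    simp at this
    linarith
  have hprod := (hasProd_rowProd hz w ((n + 1 : ℕ) : ℤ)).mul
    ((Equiv.neg ℤ).hasProd_iff.mpr (hasProd_rowProd hz w (-((n + 1 : ℕ) : ℤ))))
  refine tendsto_nhds_unique hprod.tendsto_prod_Icc_neg ?_
  have hlim := ((tendsto_prod_Icc_add_div_add (τ - w) hsin).mul
    (tendsto_prod_Icc_add_div_add (τ + w) hsin)).mul
    (((hasSum_e2Summand hz ((n + 1 : ℕ) : ℤ)).tendsto_sum_Icc_neg.const_mul (w ^ 2)).cexp)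
  rw [sin_mul_sin_div_sq, hτe, mul_right_comm _ _ (ee w), mul_right_comm _ _ (ee (-w))] at hlim
  refine hlim.congr fun N ↦ ?_
  rw [mul_sum, Complex.exp_sum, ← prod_mul_distrib, ← prod_mul_distrib]
  refine prod_congr rfl fun m _ ↦ ?_
  have hm := hτm m
  have e1 : (m : ℂ) + (((n + 1 : ℕ) : ℤ) : ℂ) * z = τ + m := by
    rw [hτ]; push_cast; ring
  have e2 : w / ((((Equiv.neg ℤ) m : ℤ) : ℂ) + ((-((n + 1 : ℕ) : ℤ) : ℤ) : ℂ) * z) =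
      -(w / (τ + m)) := by
    rw [← div_neg]
    congr 1
    rw [hτ, Equiv.neg_apply]; push_cast; ring
  simp only [Function.comp_apply]
  rw [e1, e2, primaryFactor_mul_neg]
  congr 1
  · field_simp
    ring
  · congr 1
    rw [div_pow, mul_one_div]

open Filter Topology Finset in
theorem mul_prod_Icc_rowProd {z : ℂ} (hz : 0 < z.im) (w : ℂ) (N : ℕ) :
    w * ∏ n ∈ Icc (-(N : ℤ)) N, rowProd z w n =
      Complex.sin (π * w) / π *
      Complex.exp (w ^ 2 / 2 * ∑ n ∈ Icc (-(N : ℤ)) N, EisensteinSeries.e2Summand n ⟨z, hz⟩) *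
      ((∏ l ∈ range N, (1 - ee z * ee w * ee z ^ l)) *
        (∏ l ∈ range N, (1 - ee z * ee (-w) * ee z ^ l)) /
        (∏ l ∈ range N, (1 - ee z * ee z ^ l)) ^ 2) := by
  induction N with
  | zero => simpa using mul_rowProd_zero hz w
  | succ N ih =>
    have heven := EisensteinSeries.e2Summand_even ⟨z, hz⟩ ((N + 1 : ℕ) : ℤ)
    simp only at heven
    rw [prod_Icc_neg_succ, sum_Icc_neg_succ, ← mul_assoc, ih, rowProd_mul_rowProd_neg hz, heven,
      prod_range_succ, prod_range_succ, prod_range_succ, mul_add, Complex.exp_add]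
    have : w ^ 2 / 2 * (EisensteinSeries.e2Summand ((N + 1 : ℕ) : ℤ) ⟨z, hz⟩ +
        EisensteinSeries.e2Summand ((N + 1 : ℕ) : ℤ) ⟨z, hz⟩) =
        w ^ 2 * EisensteinSeries.e2Summand ((N + 1 : ℕ) : ℤ) ⟨z, hz⟩ := by ring
    rw [this, mul_pow _ _ 2]
    simp only [div_eq_mul_inv, mul_inv]
    ring

theorem summable_norm_mul_pow {q : ℂ} (hq : ‖q‖ < 1) (Z : ℂ) :
    Summable fun l : ℕ ↦ ‖-(Z * q ^ l)‖ := by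
  simpa using (summable_geometric_of_lt_one (norm_nonneg q) hq).mul_left ‖Z‖

theorem hasProd_qPoch {q : ℂ} (hq : ‖q‖ < 1) (Z : ℂ) :
    HasProd (fun l : ℕ ↦ 1 - Z * q ^ l) (qPoch Z q) := by
  simpa [sub_eq_add_neg, qPoch] using
    (multipliable_one_add_of_summable (summable_norm_mul_pow hq Z)).hasProd

theorem qPoch_eq_one_sub_mul {q : ℂ} (hq : ‖q‖ < 1) (Z : ℂ) :
    qPoch Z q = (1 - Z) * qPoch (q * Z) q := by
  have h : (fun l : ℕ ↦ 1 - Z * q ^ (l + 1)) = fun l : ℕ ↦ 1 - q * Z * q ^ l := by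
    ext l; ring
  have := tprod_eq_zero_mul' (f := fun l : ℕ ↦ 1 - Z * q ^ l)
    (by rw [h]; exact (hasProd_qPoch hq (q * Z)).multipliable)
  rw [h] at this
  simpa [qPoch] using this

theorem qPoch_self_ne_zero {q : ℂ} (hq : ‖q‖ < 1) : qPoch q q ≠ 0 := by
  have := tprod_one_add_ne_zero_of_summable (f := fun l : ℕ ↦ -(q * q ^ l)) (fun l h ↦ ?_)
    (summable_norm_mul_pow hq q)
  · simpa [sub_eq_add_neg, qPoch] using this
  · have h1 : q ^ (l + 1) = 1 := by linear_combination -h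
    have h2 : ‖q‖ ^ (l + 1) < 1 := pow_lt_one₀ (norm_nonneg q) hq l.succ_ne_zero
    rw [← norm_pow, h1, norm_one] at h2
    exact lt_irrefl _ h2

theorem E2cl_eq_E2 {z : ℂ} (hz : 0 < z.im) : E2cl z = EisensteinSeries.E2 ⟨z, hz⟩ := by
  have h := tsum_pow_div_one_sub_eq_tsum_sigma (norm_ee_lt_one hz) 1
  rw [EisensteinSeries.E2_eq_tsum_cexp, E2cl]
  simp only [pow_one] at h
  rw [h]
  rfl

open Filter Topology Finset in
theorem tendsto_sum_e2Summand {z : ℂ} (hz : 0 < z.im) :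
    Tendsto (fun N : ℕ ↦ ∑ n ∈ Icc (-(N : ℤ)) N, EisensteinSeries.e2Summand n ⟨z, hz⟩) atTop
      (𝓝 (π ^ 2 / 3 * E2cl z)) := by
  have h := (EisensteinSeries.summable_e2Summand_symmetricIcc ⟨z, hz⟩).hasSum
  rw [HasSum, SummationFilter.symmetricIcc_eq_map_Icc_nat, tendsto_map'_iff] at h
  have hpi : (π : ℂ) ≠ 0 := by exact_mod_cast Real.pi_ne_zero
  have hE : (π ^ 2 / 3 * E2cl z : ℂ) = EisensteinSeries.G2 ⟨z, hz⟩ := by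
    rw [E2cl_eq_E2 hz, EisensteinSeries.E2, Pi.smul_apply, riemannZeta_two, smul_eq_mul]
    field_simp
    ring
  rw [hE]
  exact h

/-- The product expansion of the Weierstrass sigma function. -/
theorem wsigmaFn_eq_qPoch {z : ℂ} (hz : 0 < z.im) (w : ℂ) :
    wsigmaFn z w = Complex.exp ((π : ℂ) ^ 2 / 6 * E2cl z * w ^ 2) * (2 * Complex.sin (π * w)) *
      qPoch (ee z * ee w) (ee z) * qPoch (ee z * ee (-w)) (ee z) /
        (2 * π * qPoch (ee z) (ee z) ^ 2) := by
  have hq := norm_ee_lt_one hz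
  have hpi : (π : ℂ) ≠ 0 := by exact_mod_cast Real.pi_ne_zero
  have hne := qPoch_self_ne_zero hq
  rw [wsigmaFn_eq_mul_tprod]
  have h1 := (hasProd_rowProd_total hz w).tendsto_prod_Icc_neg.const_mul w
  simp only [mul_prod_Icc_rowProd hz w] at h1
  have h2 := ((((tendsto_sum_e2Summand hz).const_mul (w ^ 2 / 2)).cexp.const_mul
    (Complex.sin (π * w) / π))).mul
    (((hasProd_qPoch hq (ee z * ee w)).tendsto_prod_nat.mul
      (hasProd_qPoch hq (ee z * ee (-w))).tendsto_prod_nat).div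
      ((hasProd_qPoch hq (ee z)).tendsto_prod_nat.pow 2) (pow_ne_zero 2 hne))
  rw [tendsto_nhds_unique h1 h2]
  have : w ^ 2 / 2 * ((π : ℂ) ^ 2 / 3 * E2cl z) = (π : ℂ) ^ 2 / 6 * E2cl z * w ^ 2 := by ring
  rw [this]
  field_simp

theorem fracP_of_pos {x : ℝ} (h0 : 0 < x) (h1 : x < 1) : fracP x = x := by
  have : Int.fract (-x) = 1 - x := by
    rw [Int.fract_eq_iff]
    exact ⟨by linarith, by linarith, -1, by push_cast; ring⟩
  rw [fracP, this]; ring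

theorem fracP_of_nonpos {x : ℝ} (h0 : -1 < x) (h1 : x ≤ 0) : fracP x = 1 + x := by
  rw [fracP, Int.fract_eq_self.mpr ⟨by linarith, by linarith⟩]; ring

theorem two_mul_sin_pi_mul (w : ℂ) :
    2 * Complex.sin (π * w) = Complex.exp (π * Complex.I * (1 / 2 - w)) * (1 - ee w) := by
  have h : Complex.exp (π * Complex.I * (1 / 2 - w)) = Complex.I * ee (-(w / 2)) := by
    calc Complex.exp (π * Complex.I * (1 / 2 - w))
        = Complex.exp (π / 2 * Complex.I) * ee (-(w / 2)) := by
          rw [ee, ← Complex.exp_add]; ring_nf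
      _ = Complex.I * ee (-(w / 2)) := by rw [Complex.exp_pi_div_two_mul_I]
  rw [h, sin_pi_mul_eq_ee]; ring

/-- Corollary 4.9 (3.18) of the paper: the product expression of Weierstrass'
sigma function. -/
theorem statement16 (z : ℂ) (hz : 0 < z.im) (α β : ℝ)
    (hα : -1 < α) (hα' : α < 1) (hβ : -1 < β) (hβ' : β < 1) (hne : ¬(α = 0 ∧ β = 0)) :
    wsigmaFn z ((α : ℂ) + (β : ℂ) * z) =
      Complex.exp (((Real.pi : ℂ) ^ 2 / 6) * E2cl z * ((α : ℂ) + (β : ℂ) * z) ^ 2 +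
          ((Real.sign β : ℝ) : ℂ) * (Real.pi : ℂ) * Complex.I *
            (1 / 2 - ((α : ℂ) + (β : ℂ) * z))) *
        (if β = 0 then 2 * Complex.sin ((Real.pi : ℂ) * (α : ℂ)) else 1) *
        qPoch (ee ((α : ℝ) : ℂ) * ee (((fracP β : ℝ) : ℂ) * z)) (ee z) *
        qPoch (ee ((-α : ℝ) : ℂ) * ee (((fracP (-β) : ℝ) : ℂ) * z)) (ee z) /
        (2 * (Real.pi : ℂ) * qPoch (ee z) (ee z) ^ 2) := by
  have hq := norm_ee_lt_one hz
  set w : ℂ := (α : ℂ) + (β : ℂ) * z with hw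
  have hneg (c : ℝ) : ee ((-α : ℝ) : ℂ) * ee ((c : ℂ) * z) =
      ee (((β + c : ℝ) : ℂ) * z) * ee (-w) := by
    rw [← ee_add, ← ee_add, hw]; push_cast; ring_nf
  have hpos (c : ℝ) : ee (α : ℂ) * ee ((c : ℂ) * z) = ee (((c - β : ℝ) : ℂ) * z) * ee w := by
    rw [← ee_add, ← ee_add, hw]; push_cast; ring_nf
  have h1 : ee (((1 : ℝ) : ℂ) * z) = ee z := by simp
  have h0 : ee (((0 : ℝ) : ℂ) * z) = 1 := by simp [ee_zero]
  rw [wsigmaFn_eq_qPoch hz, hneg, hpos, Complex.exp_add]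
  rcases lt_trichotomy β 0 with hb | hb | hb
  · rw [fracP_of_nonpos hβ hb.le, fracP_of_pos (x := -β) (by linarith) (by linarith),
      Real.sign_of_neg hb, if_neg hb.ne, show 1 + β - β = 1 by ring, show β + -β = 0 by ring,
      h1, h0, one_mul, qPoch_eq_one_sub_mul hq (ee (-w))]
    have hs := two_mul_sin_pi_mul (-w)
    rw [mul_neg, Complex.sin_neg] at hs
    have hflip : Complex.exp (((-1 : ℝ) : ℂ) * π * Complex.I * (1 / 2 - w)) =
        -Complex.exp (π * Complex.I * (1 / 2 - -w)) := by
      rw [← mul_neg_one (Complex.exp _), ← Complex.exp_neg_pi_mul_I, ← Complex.exp_add]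
      push_cast
      ring_nf
    rw [hflip, show 2 * Complex.sin (π * w) = -(2 * -Complex.sin (π * w)) by ring, hs]
    ring
  · rw [hb, neg_zero, fracP_of_nonpos (by norm_num) le_rfl, Real.sign_zero, if_pos rfl,
      show (1 : ℝ) + 0 - 0 = 1 by ring, show (0 : ℝ) + (1 + 0) = 1 by ring, h1,
      show (α : ℂ) = w by rw [hw, hb]; simp]
    simp
  · rw [fracP_of_pos hb hβ', fracP_of_nonpos (x := -β) (by linarith) (by linarith),
      Real.sign_of_pos hb, if_neg hb.ne', show β - β = 0 by ring, show β + (1 + -β) = 1 by ring,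
      h1, h0, one_mul, qPoch_eq_one_sub_mul hq (ee w), two_mul_sin_pi_mul]
    push_cast
    ring_nf

end
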